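/- Let C be a small category, f : X₀ ⟶ X₁ a morphism in Fun(C, sSet), and X_f : [1] × C ⥤ sSet the corresponding functor (with X_f(ε, c) = X_ε(c) for ε = 0, 1 and X_f((0 → 1), 𝟙_c) = f_c). Then there exists a map of simplicial sets φ : Δ¹ × r_C^*X₀ → r_{[1]×C}^*(X_f) over Δ¹ × NC such that, under the canonical change-of-index isomorphisms identifying the fibre of r_{[1]×C}^*(X_f) over Δ^{{ε}} × NC with r_C^*(X_ε) for ε = 0, 1, the restriction of φ to Δ^{{0}} × r_C^*X₀ is the identity of r_C^*X₀ and the restriction of φ to Δ^{{1}} × r_C^*X₀ is r_C^*(f). -/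

import Mathlib

open CategoryTheory Simplicial Opposite

universe u


namespace Paper

/-- The last vertex of `u : [k] ⟶ [n]`, i.e. `u(k)`. -/
def lastV {k n : SimplexCategory} (u : k ⟶ n) : Fin (n.len + 1) :=
  u.toOrderHom (Fin.last k.len)

variable {C : Type u} [SmallCategory C]

/-- An `n`-simplex of the relative nerve `r_C^* F`: a pair `(α, x)` of an `n`-simplex
`α` of the nerve of `C` and a compatible family `x` indexed by all maps `u : [k] ⟶ [n]`,
such that for every factorisation `u = v ≫ u'` the two induced restrictions agree. -/
@[ext]
structure RNSimplex (F : C ⥤ SSet.{u}) (n : SimplexCategory) : Type u where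
  α : ComposableArrows C n.len
  x : ∀ (k : SimplexCategory) (u : k ⟶ n), (F.obj (α.obj (lastV u))).obj (op k)
  compat : ∀ (k k' : SimplexCategory) (v : k ⟶ k') (u' : k' ⟶ n),
    (F.map (α.map (homOfLE (u'.toOrderHom.monotone (Fin.le_last _))))).app (op k)
        (x k (v ≫ u'))
      = (F.obj (α.obj (lastV u'))).map v.op (x k' u')

lemma RNSimplex.ext' {F : C ⥤ SSet.{u}} {n : SimplexCategory} {s t : RNSimplex F n}
    (hα : s.α = t.α) (hx : ∀ (k : SimplexCategory) (u : k ⟶ n), HEq (s.x k u) (t.x k u)) :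
    s = t := by
  obtain ⟨α, x, hc⟩ := s
  obtain ⟨α', x', hc'⟩ := t
  obtain rfl : α = α' := hα
  simp only [mk.injEq, heq_eq_eq, true_and]
  funext k u
  exact eq_of_heq (hx k u)

/-- The relative nerve (rectification) `r_C^* F` of a diagram `F : C ⥤ sSet`. -/
def RelNerve (F : C ⥤ SSet.{u}) : SSet.{u} where
  obj n := RNSimplex F n.unop
  map {n n'} w := ↾fun s =>
    { α := s.α.whiskerLeft (SimplexCategory.toCat.map w.unop).toFunctor
      x := fun k u => s.x k (u ≫ w.unop)
      compat := fun k k' v u' => s.compat k k' v (u' ≫ w.unop) }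
  map_id n := by
    refine ConcreteCategory.hom_ext _ _ fun s => ?_
    refine RNSimplex.ext' ?_ ?_
    · show s.α.whiskerLeft (SimplexCategory.toCat.map (𝟙 n.unop)).toFunctor = s.α
      rw [CategoryTheory.Functor.map_id]
      rfl
    · intro k u
      show HEq (s.x k (u ≫ 𝟙 n.unop)) (s.x k u)
      rw [Category.comp_id]
  map_comp {n n' n''} w w' := by
    refine ConcreteCategory.hom_ext _ _ fun s => ?_
    refine RNSimplex.ext' ?_ ?_
    · show s.α.whiskerLeft (SimplexCategory.toCat.map (w ≫ w').unop).toFunctor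
        = (s.α.whiskerLeft (SimplexCategory.toCat.map w.unop).toFunctor).whiskerLeft
            (SimplexCategory.toCat.map w'.unop).toFunctor
      rw [unop_comp, CategoryTheory.Functor.map_comp]
      rfl
    · intro k u
      show HEq (s.x k (u ≫ (w ≫ w').unop)) (s.x k ((u ≫ w'.unop) ≫ w.unop))
      rw [unop_comp, Category.assoc]

/-- The canonical projection `r_C^* F ⟶ N C`. -/
def relNerveProj (F : C ⥤ SSet.{u}) : RelNerve F ⟶ nerve C where
  app _ := ↾fun s => s.α
  naturality _ _ _ := rfl

end Paper

namespace Paper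

variable {C : Type u} [SmallCategory C]

/-- The map `r_C^*(f) : r_C^* F ⟶ r_C^* G` induced by a natural transformation `f : F ⟶ G`,
given by `(α, x) ↦ (α, (f(x_u))_u)`. -/
def relNerveMap {F G : C ⥤ SSet.{u}} (f : F ⟶ G) : RelNerve F ⟶ RelNerve G where
  app n := ↾fun s =>
    { α := s.α
      x := fun k u => (f.app (s.α.obj (lastV u))).app (op k) (s.x k u)
      compat := by
        intro k k' v u'
        exact (ConcreteCategory.congr_hom (NatTrans.congr_app
            (f.naturality (s.α.map (homOfLE (u'.toOrderHom.monotone (Fin.le_last _)))))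
            (op k)) (s.x k (v ≫ u'))).symm.trans
          ((congrArg (fun y => (f.app (s.α.obj (lastV u'))).app (op k) y)
            (s.compat k k' v u')).trans
          (ConcreteCategory.congr_hom ((f.app (s.α.obj (lastV u'))).naturality v.op)
            (s.x k' u'))) }
  naturality n n' w := rfl

/-- The relative nerve as a functor `Fun(C, sSet) ⥤ sSet/N C`. -/
def relNerveFunctor (C : Type u) [SmallCategory C] :
    (C ⥤ SSet.{u}) ⥤ Over (nerve C) where
  obj F := Over.mk (relNerveProj F)
  map f := Over.homMk (relNerveMap f) rfl

end Paper

namespace Paper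

variable {C : Type u} [SmallCategory C]

/-- The nerve of a functor `ψ : D ⥤ C`, i.e. the induced map `N ψ : N D ⟶ N C`. -/
def nerveMapF {D : Type u} [SmallCategory D] (ψ : D ⥤ C) : nerve D ⟶ nerve C where
  app _ := ↾fun α => α ⋙ ψ
  naturality _ _ _ := rfl

/-- The change-of-index comparison map `r_D^*(ψ^* F) ⟶ r_C^* F`, sending `(α, x)` to
`(ψ ∘ α, x)`. -/
def relNerveComparison {D : Type u} [SmallCategory D] (ψ : D ⥤ C) (F : C ⥤ SSet.{u}) :
    RelNerve (ψ ⋙ F) ⟶ RelNerve F where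
  app n := ↾fun s =>
    { α := s.α ⋙ ψ
      x := fun k u => s.x k u
      compat := fun k k' v u' => s.compat k k' v u' }
  naturality _ _ _ := rfl

end Paper
namespace Paper

/-- The (objectwise) product of two simplicial sets. -/
def sprod (A B : SSet.{u}) : SSet.{u} where
  obj n := A.obj n × B.obj n
  map w := ↾fun p => (A.map w p.1, B.map w p.2)
  map_id n := by refine ConcreteCategory.hom_ext _ _ fun p => ?_; simp
  map_comp f g := by refine ConcreteCategory.hom_ext _ _ fun p => ?_; simp

/-- The product of two maps of simplicial sets. -/
def sprodMap {A A' B B' : SSet.{u}} (f : A ⟶ A') (g : B ⟶ B') : sprod A B ⟶ sprod A' B' where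
  app n := ↾fun p => (f.app n p.1, g.app n p.2)
  naturality m m' w := by
    refine ConcreteCategory.hom_ext _ _ fun p => ?_
    obtain ⟨a, b⟩ : A.obj m × B.obj m := p
    have hf : f.app m' (A.map w a) = A'.map w (f.app m a) :=
      ConcreteCategory.congr_hom (f.naturality w) a
    have hg : g.app m' (B.map w b) = B'.map w (g.app m b) :=
      ConcreteCategory.congr_hom (g.naturality w) b
    exact Prod.ext hf hg

/-- The inclusion `X ≅ Δ^{(k)} × X ⟶ Δ¹ × X` at the vertex `k`. -/
def vertexIncl (k : Fin 2) (X : SSet.{u}) : X ⟶ sprod Δ[1] X where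
  app n := ↾fun x => (SSet.stdSimplex.const 1 k n, x)
  naturality m m' w := by
    refine ConcreteCategory.hom_ext _ _ fun x => ?_
    refine Prod.ext ?_ rfl
    rfl

/-- Two maps `f g : X ⟶ K` are (simplicially) homotopic if there is a homotopy
`H : Δ¹ × X ⟶ K` from `f` to `g`. -/
def SHomotopic {X K : SSet.{u}} (f g : X ⟶ K) : Prop :=
  ∃ H : sprod Δ[1] X ⟶ K, vertexIncl 0 X ≫ H = f ∧ vertexIncl 1 X ≫ H = g

/-- Homotopy classes of maps `X ⟶ K`. -/
def HtpyClasses (X K : SSet.{u}) : Type u :=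
  Quot (fun f g : X ⟶ K => SHomotopic f g)

lemma vertexIncl_naturality {X Y : SSet.{u}} (k : Fin 2) (f : X ⟶ Y) :
    vertexIncl k X ≫ sprodMap (𝟙 Δ[1]) f = f ≫ vertexIncl k Y := rfl

/-- Precomposition with `f : X ⟶ Y` on homotopy classes of maps into `K`. -/
def precompCls {X Y : SSet.{u}} (f : X ⟶ Y) (K : SSet.{u}) :
    HtpyClasses Y K → HtpyClasses X K :=
  Quot.map (fun g => f ≫ g) (by
    rintro g g' ⟨H, h0, h1⟩
    refine ⟨sprodMap (𝟙 Δ[1]) f ≫ H, ?_, ?_⟩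
    · rw [← Category.assoc, vertexIncl_naturality, Category.assoc, h0]
    · rw [← Category.assoc, vertexIncl_naturality, Category.assoc, h1])

/-- A Kan complex: a simplicial set with the extension property along all horn
inclusions `Λᵏᵢ ⊆ Δᵏ`. -/
def IsKan (K : SSet.{u}) : Prop :=
  ∀ ⦃n : ℕ⦄ ⦃i : Fin (n + 1)⦄ (σ₀ : (Λ[n, i] : SSet.{u}) ⟶ K), ∃ σ : Δ[n] ⟶ K,
    σ₀ = Λ[n, i].ι ≫ σ

/-- A map `f : X ⟶ Y` of simplicial sets is a weak homotopy equivalence (equivalently, a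
weak equivalence in the Kan–Quillen model structure) if for every Kan complex `K` the
induced map `[Y, K] ⟶ [X, K]` on homotopy classes of maps is a bijection. -/
def WeakHomotopyEquiv {X Y : SSet.{u}} (f : X ⟶ Y) : Prop :=
  ∀ K : SSet.{u}, IsKan K → Function.Bijective (precompCls f K)

end Paper

namespace Paper

variable {C : Type u} [SmallCategory C]

/-- The functor `[1] × C ⥤ sSet` corresponding to a morphism `f : X₀ ⟶ X₁` in
`Fun(C, sSet)`, with `X_f(ε, c) = X_ε(c)` and `X_f((0 → 1), 𝟙_c) = f_c`. -/
def arrowDiagram {X₀ X₁ : C ⥤ SSet.{u}} (f : X₀ ⟶ X₁) : (Fin 2) × C ⥤ SSet.{u} :=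
  CategoryTheory.Functor.uncurry.obj (ComposableArrows.mk₁ f)

/-- The inclusion `C ⥤ [1] × C` at the vertex `ε`. -/
def vertFunctor (C : Type u) [SmallCategory C] (ε : Fin 2) : C ⥤ (Fin 2) × C :=
  Functor.prod' ((Functor.const C).obj ε) (𝟭 C)

/-- The canonical identification of the fibre functor: `X₀ ⟶ j₀ ⋙ X_f`. -/
def fib0 {X₀ X₁ : C ⥤ SSet.{u}} (f : X₀ ⟶ X₁) : X₀ ⟶ vertFunctor C 0 ⋙ arrowDiagram f where
  app c := 𝟙 (X₀.obj c)
  naturality c c' g := by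
    show X₀.map g ≫ 𝟙 (X₀.obj c') = 𝟙 (X₀.obj c) ≫ 𝟙 (X₀.obj c) ≫ X₀.map g
    simp

/-- The canonical identification of the fibre functor: `X₁ ⟶ j₁ ⋙ X_f`. -/
def fib1 {X₀ X₁ : C ⥤ SSet.{u}} (f : X₀ ⟶ X₁) : X₁ ⟶ vertFunctor C 1 ⋙ arrowDiagram f where
  app c := 𝟙 (X₁.obj c)
  naturality c c' g := by
    show X₁.map g ≫ 𝟙 (X₁.obj c') = 𝟙 (X₁.obj c) ≫ 𝟙 (X₁.obj c) ≫ X₁.map g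
    simp

/-- The canonical isomorphism `N([1] × C) ⟶ Δ¹ × N C`. -/
def nerveProdDecomp (C : Type u) [SmallCategory C] :
    nerve ((Fin 2) × C) ⟶ sprod Δ[1] (nerve C) where
  app n := ↾fun β =>
    (ULift.up (SimplexCategory.Hom.mk
        ⟨fun i => (β.obj i).1, fun i j h => leOfHom (β.map (homOfLE h)).1⟩),
      β ⋙ CategoryTheory.Prod.snd _ _)
  naturality _ _ _ := rfl

/-- The transformation `X₀ ∘ snd ⟶ X_f` given by the maps `(0 ≤ ε, 𝟙 c)`. -/
def cylTrans {X₀ X₁ : C ⥤ SSet.{u}} (f : X₀ ⟶ X₁) :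
    CategoryTheory.Prod.snd (Fin 2) C ⋙ X₀ ⟶ arrowDiagram f where
  app p := ((ComposableArrows.mk₁ f).map (homOfLE (Fin.zero_le p.1))).app p.2
  naturality p q g := by
    have h1 : homOfLE (Fin.zero_le p.1) ≫ g.1 = homOfLE (Fin.zero_le q.1) :=
      Subsingleton.elim _ _
    have h2 := ((ComposableArrows.mk₁ f).map (homOfLE (Fin.zero_le q.1))).naturality g.2
    refine h2.trans ?_
    rw [← h1, Functor.map_comp, NatTrans.comp_app, Category.assoc]
    rfl

/-- The map `(δ, (α, x)) ↦ ((δ, α), x)`. -/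
def cylPre (X₀ : C ⥤ SSet.{u}) :
    sprod Δ[1] (RelNerve X₀) ⟶ RelNerve (CategoryTheory.Prod.snd (Fin 2) C ⋙ X₀) where
  app n := ↾fun p =>
    { α := Functor.prod' (p.1.down.toOrderHom.monotone.functor) p.2.α
      x := fun k u => p.2.x k u
      compat := fun k k' v u' => p.2.compat k k' v u' }
  naturality _ _ _ := rfl

/-- **Statement 18.** For a morphism `f : X₀ ⟶ X₁` in `Fun(C, sSet)` with corresponding
functor `X_f : [1] × C ⥤ sSet`, there is a map `φ : Δ¹ × r_C^* X₀ ⟶ r_{[1]×C}^*(X_f)`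
over `Δ¹ × N C` whose restriction to `Δ^{0} × r_C^* X₀` is the identity of `r_C^* X₀` and
whose restriction to `Δ^{1} × r_C^* X₀` is `r_C^*(f)`, under the canonical change-of-index
identifications of the fibres of `r_{[1]×C}^*(X_f)` with `r_C^*(X₀)` and `r_C^*(X₁)`. -/
theorem relNerve_cylinder_exists {X₀ X₁ : C ⥤ SSet.{u}} (f : X₀ ⟶ X₁) :
    ∃ φ : sprod Δ[1] (RelNerve X₀) ⟶ RelNerve (arrowDiagram f),
      (φ ≫ (relNerveProj (arrowDiagram f) ≫ nerveProdDecomp C)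
        = sprodMap (𝟙 Δ[1]) (relNerveProj X₀)) ∧
      (vertexIncl 0 (RelNerve X₀) ≫ φ
        = relNerveMap (fib0 f) ≫ relNerveComparison (vertFunctor C 0) (arrowDiagram f)) ∧
      (vertexIncl 1 (RelNerve X₀) ≫ φ
        = (relNerveMap f ≫ relNerveMap (fib1 f)) ≫
            relNerveComparison (vertFunctor C 1) (arrowDiagram f)) := by
  refine ⟨cylPre X₀ ≫ relNerveMap (cylTrans f), ?_, ?_, ?_⟩
  · refine NatTrans.ext (funext fun n => ConcreteCategory.hom_ext _ _ fun p => ?_)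
    obtain ⟨⟨d⟩, s⟩ : Δ[1].obj n × (RelNerve X₀).obj n := p
    refine Prod.ext ?_ rfl
    refine congrArg ULift.up ?_
    exact SimplexCategory.Hom.ext _ _ (OrderHom.ext _ _ rfl)
  · ext n s
    refine RNSimplex.ext' rfl fun k u => heq_of_eq ?_
    have h : (ComposableArrows.mk₁ f).map (homOfLE (Fin.zero_le (0 : Fin 2))) = 𝟙 _ :=
      (ComposableArrows.mk₁ f).map_id 0
    exact ConcreteCategory.congr_hom
      (NatTrans.congr_app (NatTrans.congr_app h (s.α.obj (lastV u))) (op k)) (s.x k u)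
  · ext n s
    exact RNSimplex.ext' rfl fun k u => HEq.rfl

end Paper
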